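/- arXiv:1404.7711 — 2 statements merged into one kernel-verified Lean document; each statement's English description precedes it below -/
import Mathlib

section
/- Fix n ≥ 1 and p ∈ (0,1). For every placement x ∈ [0,1]^n, C(x^eq) ≤ C(x) + (p/(1−p)) · (2/n). In particular, with x* an optimal placement, C(x^eq) ≤ C(x*) + 2p/((1−p)n). -/
open Finset MeasureTheory

/-- Coverage cost on the line `[0,1]` for placement `x` and active set `A`:
the largest distance from a point of `[0,1]` to the closest active sensor
(`1` by convention if `A = ∅`). -/
noncomputable def cost0 {n : ℕ} (x : Fin n → ℝ) (A : Finset (Fin n)) : ℝ :=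
  if A.Nonempty then ⨆ s : Set.Icc (0:ℝ) 1, ⨅ j : A, |s.1 - x j.1| else 1

/-- Probability that `A` is the active set, under independent failures with
probability `p`. -/
noncomputable def prob {n : ℕ} (p : ℝ) (A : Finset (Fin n)) : ℝ :=
  p ^ (n - A.card) * (1 - p) ^ A.card

/-- Expected coverage cost `C(x)` under independent failures with probability `p`. -/
noncomputable def expCost {n : ℕ} (p : ℝ) (x : Fin n → ℝ) : ℝ :=
  ∑ A : Finset (Fin n), prob p A * cost0 x A

/-- The equispaced placement `x^eq`, whose `i`-th entry (`i = 0, …, n-1`) is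
`(2i+1)/(2n)`. -/
noncomputable def xeq (n : ℕ) : Fin n → ℝ := fun i => (2 * (i : ℝ) + 1) / (2 * n)

/-- The `k`-th smallest element of the finite set `A` (0-based). -/
noncomputable def nth {n : ℕ} (A : Finset (Fin n)) (k : Fin A.card) : Fin n :=
  (A.orderIsoOfFin rfl k).1

/-- Coverage cost on the circle of circumference 1 for the active set `A`. -/
noncomputable def ccost0 {n : ℕ} (x : Fin n → ℝ) (A : Finset (Fin n)) : ℝ :=
  if A.Nonempty then
    ⨆ s : Set.Icc (0:ℝ) 1, ⨅ j : A, min |s.1 - x j.1| (1 - |s.1 - x j.1|)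
  else 1

/-- Expected circle coverage cost `C̃(x)`. -/
noncomputable def cExpCost {n : ℕ} (p : ℝ) (x : Fin n → ℝ) : ℝ :=
  ∑ A : Finset (Fin n), prob p A * ccost0 x A

/-- Harmonic number `H_m = ∑_{h=1}^m 1/h`. -/
noncomputable def H (m : ℕ) : ℝ := ∑ i ∈ Finset.range m, 1 / ((i : ℝ) + 1)

/-- Length of the longest run of consecutive indices of `{0, …, n-1}` not
belonging to `A`. -/
noncomputable def longestRun {n : ℕ} (A : Finset (Fin n)) : ℕ :=
  sSup {r : ℕ | ∃ a : ℕ, a + r ≤ n ∧ ∀ i : Fin n, a ≤ i.1 → i.1 < a + r → i ∉ A}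

/-- Expected cost in the Cortés (constant-number-of-failures) model where
exactly `k` sensors fail, uniformly at random. -/
noncomputable def cortesCost {n : ℕ} (k : ℕ) (x : Fin n → ℝ) : ℝ :=
  (n.choose k : ℝ)⁻¹ *
    ∑ A ∈ Finset.univ.filter (fun A : Finset (Fin n) => A.card = n - k), cost0 x A

/-- Expectation over the random uniform i.i.d. placement `x^rand ∈ [0,1]^n`
of the expected cost `C(x^rand)`. -/
noncomputable def randExp (n : ℕ) (p : ℝ) : ℝ :=
  ∫ x in Set.univ.pi (fun _ : Fin n => Set.Icc (0:ℝ) 1), expCost p x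

/-- `E[C_0(x^{rand,m})]`: expected coverage cost of `m` i.i.d. uniform sensors,
all active. -/
noncomputable def randCost0 (m : ℕ) : ℝ :=
  ∫ x in Set.univ.pi (fun _ : Fin m => Set.Icc (0:ℝ) 1), cost0 x Finset.univ

/-- `E[C^{k,n}(x^rand)]`: expectation over the random placement of the Cortés
model cost. -/
noncomputable def randCortes (n k : ℕ) : ℝ :=
  ∫ x in Set.univ.pi (fun _ : Fin n => Set.Icc (0:ℝ) 1), cortesCost k x

/-- Relabelling the sensors moves the active set. -/
lemma cost0_comp_perm {n : ℕ} (x : Fin n → ℝ) (σ : Equiv.Perm (Fin n)) (A : Finset (Fin n)) :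
    cost0 (x ∘ σ) A = cost0 x (A.map σ.toEmbedding) := by
  unfold cost0
  have hσ : ∀ s : ℝ, (⨅ j : A, |s - (x ∘ σ) j.1|) =
      ⨅ j : (A.map σ.toEmbedding : Finset (Fin n)), |s - x j.1| := by
    intro s
    have e : Function.Surjective (fun j : A =>
        (⟨σ j.1, by simp [j.2]⟩ : (A.map σ.toEmbedding : Finset (Fin n)))) := by
      rintro ⟨j, hj⟩
      obtain ⟨i, hi, rfl⟩ := Finset.mem_map.1 hj
      exact ⟨⟨i, hi⟩, rfl⟩
    exact e.iInf_comp (fun j : (A.map σ.toEmbedding : Finset (Fin n)) => |s - x j.1|)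
  simp only [hσ, Finset.map_nonempty]

/-- The expected cost does not depend on the labelling of the sensors. -/
lemma expCost_comp_perm {n : ℕ} (p : ℝ) (x : Fin n → ℝ) (σ : Equiv.Perm (Fin n)) :
    expCost p (x ∘ σ) = expCost p x := by
  unfold expCost
  rw [← Equiv.sum_comp (Equiv.finsetCongr σ) (fun A => prob p A * cost0 x A)]
  refine Finset.sum_congr rfl fun A _ => ?_
  rw [cost0_comp_perm, Equiv.finsetCongr_apply, prob, prob, Finset.card_map]

lemma bddBelow_range_abs_sub {n : ℕ} (x : Fin n → ℝ) (A : Finset (Fin n)) (s : ℝ) :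
    BddBelow (Set.range fun j : A => |s - x j.1|) :=
  ⟨0, by rintro _ ⟨j, rfl⟩; exact abs_nonneg _⟩

/-- A point of `[0,1]` at distance at least `c` from all active sensors bounds the cost below. -/
lemma le_cost0 {n : ℕ} (x : Fin n → ℝ) {A : Finset (Fin n)} (hA : A.Nonempty) {c s : ℝ}
    (hs : s ∈ Set.Icc (0:ℝ) 1) (h : ∀ j ∈ A, c ≤ |s - x j|) : c ≤ cost0 x A := by
  have hne : Nonempty A := hA.to_subtype
  rw [cost0, if_pos hA]
  have hbdd : BddAbove (Set.range fun s : Set.Icc (0:ℝ) 1 => ⨅ j : A, |s.1 - x j.1|) := by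
    obtain ⟨i, hi⟩ := hA
    refine ⟨1 + |x i|, ?_⟩
    rintro _ ⟨u, rfl⟩
    refine (ciInf_le (bddBelow_range_abs_sub x A u.1) ⟨i, hi⟩).trans ?_
    refine (abs_sub _ _).trans ?_
    rw [abs_of_nonneg u.2.1]
    exact add_le_add_left u.2.2 _
  exact (le_ciInf fun j : A => h j.1 j.2).trans (le_ciSup hbdd ⟨s, hs⟩)

/-- If every point of `[0,1]` is within distance `c` of some active sensor, the cost is at most
`c`. -/
lemma cost0_le {n : ℕ} (x : Fin n → ℝ) {A : Finset (Fin n)} (hA : A.Nonempty) {c : ℝ}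
    (h : ∀ s ∈ Set.Icc (0:ℝ) 1, ∃ j ∈ A, |s - x j| ≤ c) : cost0 x A ≤ c := by
  rw [cost0, if_pos hA]
  have : Nonempty (Set.Icc (0:ℝ) 1) := ⟨⟨0, by simp⟩⟩
  refine ciSup_le fun s => ?_
  obtain ⟨j, hj, hc⟩ := h s.1 s.2
  exact (ciInf_le (bddBelow_range_abs_sub x A s.1) ⟨j, hj⟩).trans hc

/-- Half the gap between two positions of a quasi-periodic monotone placement `Y`, with no active
sensor strictly in between, bounds the cost below. -/
lemma half_gap_le_cost0 {n : ℕ} (y : Fin n → ℝ) {A : Finset (Fin n)} (hA : A.Nonempty)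
    {Y : ℤ → ℝ} (hY : Monotone Y) (hper : ∀ (k z : ℤ), Y (k + z * n) = Y k + z)
    (hy : ∀ j, ∃ z : ℤ, y j = Y j.1 - z) {a b : ℕ} (hbn : b ≤ n)
    (hgap : ∀ j ∈ A, j.1 ≤ a ∨ b ≤ j.1) : (Y b - Y a) / 2 ≤ cost0 y A := by
  set m := (Y a + Y b) / 2 with hm
  refine le_cost0 y hA (s := Int.fract m) ⟨Int.fract_nonneg m, (Int.fract_lt_one m).le⟩ ?_
  intro j hj
  obtain ⟨z, hz⟩ := hy j
  have hshift : Int.fract m - y j = m - Y (j.1 + (⌊m⌋ - z) * n) := by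
    have hk := hper j.1 (⌊m⌋ - z)
    push_cast at hk
    rw [hk, hz, Int.fract]
    ring
  rw [hshift]
  generalize ⌊m⌋ - z = w
  have hjn : (j.1 : ℤ) < n := by exact_mod_cast j.2
  have hside : (j.1 : ℤ) + w * n ≤ a ∨ (b : ℤ) ≤ j.1 + w * n := by
    rcases lt_trichotomy w 0 with hw | rfl | hw
    · left; nlinarith
    · have := hgap j hj
      omega
    · right
      have : (b : ℤ) ≤ n := by exact_mod_cast hbn
      nlinarith
  rcases hside with h | h
  · have := hY h
    exact le_trans (by linarith) (le_abs_self _)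
  · have := hY h
    exact le_trans (by linarith) (neg_le_abs _)

/-- Shifting a quasi-periodic sequence by `c` adds `c` to its sum over a period. -/
lemma sum_shift_eq {n : ℕ} {X : ℤ → ℝ} (hper : ∀ k : ℤ, X (k + n) = X k + 1) (c : ℕ) :
    ∑ t ∈ Finset.range n, X (c + t) = ∑ t ∈ Finset.range n, X t + c := by
  induction c with
  | zero => simp
  | succ c ih =>
    have h1 := Finset.sum_range_succ (fun t : ℕ => X (c + t)) n
    have h2 := Finset.sum_range_succ' (fun t : ℕ => X (c + t)) n
    have h3 := hper c
    have h4 : ∑ t ∈ Finset.range n, X ((c + 1 : ℕ) + t) =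
        ∑ t ∈ Finset.range n, X (c + (t + 1 : ℕ)) :=
      Finset.sum_congr rfl fun t _ => by congr 1; push_cast; ring
    simp only [Nat.cast_zero, add_zero] at h2
    rw [h4]
    push_cast at *
    linarith

/-- The quasi-periodic extension to `ℤ` of a placement on `[0,1]`. -/
noncomputable def periodicExt {n : ℕ} [NeZero n] (x : Fin n → ℝ) (k : ℤ) : ℝ :=
  x (Fin.ofNat n (k % n).toNat) + (k / n : ℤ)

lemma periodicExt_monotone {n : ℕ} [NeZero n] {x : Fin n → ℝ} (hmono : Monotone x)
    (hx : ∀ i, x i ∈ Set.Icc (0:ℝ) 1) : Monotone (periodicExt x) := by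
  intro k l hkl
  have hn : (0 : ℤ) < n := by exact_mod_cast NeZero.pos n
  have hdiv : k / n ≤ l / n := Int.ediv_le_ediv hn hkl
  unfold periodicExt
  rcases hdiv.eq_or_lt with h | h
  · rw [h]
    have hk := Int.emod_nonneg k hn.ne'
    have hl := Int.emod_nonneg l hn.ne'
    have hk' := Int.emod_lt_of_pos k hn
    have hl' := Int.emod_lt_of_pos l hn
    have hek := Int.mul_ediv_add_emod k n
    have hel := Int.mul_ediv_add_emod l n
    rw [h] at hek
    gcongr
    apply hmono
    rw [Fin.le_def, Fin.val_ofNat, Fin.val_ofNat, Nat.mod_eq_of_lt (by omega),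
      Nat.mod_eq_of_lt (by omega)]
    omega
  · have h' : ((k / n : ℤ) : ℝ) + 1 ≤ (l / n : ℤ) := by exact_mod_cast h
    linarith [(hx (Fin.ofNat n (k % n).toNat)).2, (hx (Fin.ofNat n (l % n).toNat)).1]

lemma periodicExt_add_mul {n : ℕ} [NeZero n] (x : Fin n → ℝ) (k z : ℤ) :
    periodicExt x (k + z * n) = periodicExt x k + z := by
  have hn : (n : ℤ) ≠ 0 := by exact_mod_cast NeZero.ne n
  unfold periodicExt
  rw [Int.add_mul_emod_self_right, Int.add_mul_ediv_right _ _ hn]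
  push_cast
  ring

lemma comp_addRight_eq_periodicExt {n : ℕ} [NeZero n] (x : Fin n → ℝ) (t j : Fin n) :
    ∃ z : ℤ, (x ∘ Equiv.addRight t) j = periodicExt x (j.1 + t.1) - z := by
  refine ⟨((j.1 + t.1 : ℤ) / n : ℤ), ?_⟩
  have : Fin.ofNat n (((j.1 : ℤ) + t.1) % n).toNat = j + t := by
    apply Fin.ext
    rw [Fin.val_ofNat, Fin.val_add]
    have : ((j.1 : ℤ) + t.1) % n = ((j.1 + t.1) % n : ℕ) := by push_cast; rfl
    rw [this, Int.toNat_natCast, Nat.mod_mod]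
  simp only [Function.comp_apply, Equiv.coe_addRight, periodicExt, this]
  ring

/-- Average cost of the active set `A` over all cyclic relabellings of the sensors. -/
noncomputable def cyclicCost {n : ℕ} [NeZero n] (x : Fin n → ℝ) (A : Finset (Fin n)) : ℝ :=
  (∑ t : Fin n, cost0 (x ∘ Equiv.addRight t) A) / n

lemma expCost_eq_sum_cyclicCost {n : ℕ} [NeZero n] (p : ℝ) (x : Fin n → ℝ) :
    expCost p x = ∑ A : Finset (Fin n), prob p A * cyclicCost x A := by
  have hn : (n : ℝ) ≠ 0 := by exact_mod_cast NeZero.ne n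
  have h : ∑ t : Fin n, expCost p (x ∘ Equiv.addRight t) = n * expCost p x := by
    simp only [expCost_comp_perm, Finset.sum_const, Finset.card_univ,
      Fintype.card_fin, nsmul_eq_mul]
  rw [← mul_right_inj' hn, ← h]
  simp only [expCost, cyclicCost]
  rw [Finset.sum_comm, Finset.mul_sum]
  refine Finset.sum_congr rfl fun A _ => ?_
  rw [← Finset.mul_sum]
  field_simp

lemma gap_le_cyclicCost {n : ℕ} [NeZero n] {x : Fin n → ℝ} (hmono : Monotone x)
    (hx : ∀ i, x i ∈ Set.Icc (0:ℝ) 1) {A : Finset (Fin n)} (hA : A.Nonempty)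
    {a b : ℕ} (hbn : b ≤ n) (hgap : ∀ j ∈ A, j.1 ≤ a ∨ b ≤ j.1) :
    ((b : ℝ) - a) / (2 * n) ≤ cyclicCost x A := by
  have hn : (0 : ℝ) < n := by exact_mod_cast NeZero.pos n
  have hbound : ∀ t : Fin n, (periodicExt x (b + t.1) - periodicExt x (a + t.1)) / 2 ≤
      cost0 (x ∘ Equiv.addRight t) A := fun t =>
    half_gap_le_cost0 (x ∘ Equiv.addRight t) hA (Y := fun k => periodicExt x (k + t.1))
      (fun k l hkl => periodicExt_monotone hmono hx (by omega))
      (fun k z => by rw [← periodicExt_add_mul]; congr 1; ring)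
      (fun j => comp_addRight_eq_periodicExt x t j) hbn hgap
  have hsum := Finset.sum_le_sum fun t (_ : t ∈ Finset.univ) => hbound t
  have hper : ∀ k : ℤ, periodicExt x (k + n) = periodicExt x k + 1 := fun k => by
    simpa using periodicExt_add_mul x k 1
  rw [← Finset.sum_div, Finset.sum_sub_distrib,
    Fin.sum_univ_eq_sum_range (fun t => periodicExt x (b + t)),
    Fin.sum_univ_eq_sum_range (fun t => periodicExt x (a + t)),
    sum_shift_eq hper, sum_shift_eq hper] at hsum
  rw [cyclicCost, le_div_iff₀ hn]
  calc ((b : ℝ) - a) / (2 * n) * n = (b - a) / 2 := by field_simp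
    _ ≤ _ := by linarith

/-- The indices larger than `k`. -/
def indicesAbove (n k : ℕ) : Finset (Fin n) := Finset.univ.filter fun j => k < j.1

/-- The indices whose mirror image is larger than `k`. -/
def indicesBelow (n k : ℕ) : Finset (Fin n) := Finset.univ.filter fun j => k < j.rev.1

lemma card_indicesAbove (n k : ℕ) : (indicesAbove n k).card = n - 1 - k := by
  have hcompl : indicesAbove n k = (Finset.univ.filter fun j : Fin n => j.1 < k + 1)ᶜ := by
    ext j
    simp only [indicesAbove, Finset.mem_compl, Finset.mem_filter_univ]
    omega
  rw [hcompl, Finset.card_compl, Fin.card_filter_val_lt, Fintype.card_fin]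
  omega

lemma card_indicesBelow (n k : ℕ) : (indicesBelow n k).card = n - 1 - k := by
  rw [← card_indicesAbove, indicesBelow, indicesAbove]
  exact Finset.card_equiv Fin.revPerm fun j => by
    simp only [Finset.mem_filter_univ, Fin.revPerm_apply]

/-- The number of `k < n` with `A ⊆ S k`. -/
def countSubset {n : ℕ} (S : ℕ → Finset (Fin n)) (A : Finset (Fin n)) : ℕ :=
  ((Finset.range n).filter fun k => A ⊆ S k).card

lemma le_countSubset {n : ℕ} {S : ℕ → Finset (Fin n)} {A : Finset (Fin n)} {m : ℕ} (hm : m ≤ n)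
    (h : ∀ k < m, A ⊆ S k) : m ≤ countSubset S A := by
  calc m = (Finset.range m).card := (Finset.card_range m).symm
    _ ≤ countSubset S A := Finset.card_le_card fun k hk => by
      have := Finset.mem_range.1 hk
      exact Finset.mem_filter.2 ⟨Finset.mem_range.2 (by omega), h k this⟩

/-- The probability that all active sensors lie in `S`. -/
lemma sum_prob_subset {n : ℕ} (p : ℝ) (S : Finset (Fin n)) :
    ∑ A ∈ S.powerset, prob p A = p ^ (n - S.card) := by
  have hS : S.card ≤ n := by simpa using S.card_le_univ
  have h := Finset.sum_pow_mul_eq_add_pow (1 - p) p S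
  rw [sub_add_cancel, one_pow] at h
  rw [← mul_one (p ^ (n - S.card)), ← h, Finset.mul_sum]
  refine Finset.sum_congr rfl fun A hA => ?_
  have hAS := Finset.card_le_card (Finset.mem_powerset.1 hA)
  rw [prob, show n - A.card = (n - S.card) + (S.card - A.card) by omega, pow_add]
  ring

lemma sum_prob_mul_countSubset_le {n : ℕ} {p : ℝ} (hp : p ∈ Set.Ioo (0:ℝ) 1)
    {S : ℕ → Finset (Fin n)} (hS : ∀ k, (S k).card = n - 1 - k) :
    ∑ A : Finset (Fin n), prob p A * countSubset S A ≤ p / (1 - p) := by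
  have hp1 : 0 < 1 - p := by linarith [hp.2]
  calc ∑ A : Finset (Fin n), prob p A * countSubset S A
      = ∑ k ∈ Finset.range n, ∑ A ∈ (S k).powerset, prob p A := by
        simp only [countSubset, Finset.card_filter, Nat.cast_sum, Finset.mul_sum]
        rw [Finset.sum_comm]
        refine Finset.sum_congr rfl fun k _ => ?_
        rw [← Finset.filter_subset_univ, Finset.sum_filter]
        refine Finset.sum_congr rfl fun A _ => ?_
        split_ifs <;> simp
    _ = ∑ k ∈ Finset.range n, p * p ^ k := by
        refine Finset.sum_congr rfl fun k hk => ?_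
        have := Finset.mem_range.1 hk
        rw [sum_prob_subset, hS, ← pow_succ', show n - (n - 1 - k) = k + 1 by omega]
    _ = p * ((1 - p ^ n) / (1 - p)) := by
        rw [← Finset.mul_sum, geom_sum_eq hp.2.ne, ← neg_div_neg_eq, neg_sub, neg_sub]
    _ ≤ p / (1 - p) := by
        rw [← mul_div_assoc]
        gcongr
        nlinarith [pow_pos hp.1 n, hp.1]

lemma cost0_xeq_le {n : ℕ} [NeZero n] {x : Fin n → ℝ} (hmono : Monotone x)
    (hx : ∀ i, x i ∈ Set.Icc (0:ℝ) 1) (A : Finset (Fin n)) :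
    cost0 (xeq n) A ≤ cyclicCost x A +
      (countSubset (indicesAbove n) A + countSubset (indicesBelow n) A) / n := by
  have hn : (0 : ℝ) < n := by exact_mod_cast NeZero.pos n
  rcases A.eq_empty_or_nonempty with rfl | hA
  · have : cyclicCost x ∅ = 1 := by simp [cyclicCost, cost0, hn.ne']
    rw [this]
    have : cost0 (xeq n) ∅ = 1 := by simp [cost0]
    rw [this]
    exact le_add_of_nonneg_right (by positivity)
  have hunit : 1 / (2 * n) ≤ cyclicCost x A := by
    simpa using gap_le_cyclicCost hmono hx hA (a := 0) (b := 1) (NeZero.pos n)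
      (fun j _ => by omega)
  refine cost0_le _ hA fun s hs => ?_
  rw [add_div]
  have hF : (0 : ℝ) ≤ countSubset (indicesAbove n) A / n := by positivity
  have hL : (0 : ℝ) ≤ countSubset (indicesBelow n) A / n := by positivity
  rcases (A.filter fun j => xeq n j ≤ s).eq_empty_or_nonempty with hlo | hlo
  · refine ⟨A.min' hA, A.min'_mem hA, ?_⟩
    have hs' : s < xeq n (A.min' hA) :=
      not_le.1 (Finset.filter_eq_empty_iff.1 hlo (A.min'_mem hA))
    have hcount : (A.min' hA).1 ≤ countSubset (indicesAbove n) A :=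
      le_countSubset (A.min' hA).2.le fun k hk j hj => by
        have : A.min' hA ≤ j := A.min'_le j hj
        simp only [indicesAbove, Finset.mem_filter_univ]
        exact hk.trans_le this
    have hcount' : ((A.min' hA).1 : ℝ) / n ≤ countSubset (indicesAbove n) A / n := by
      gcongr
    have hxeq : xeq n (A.min' hA) = (A.min' hA).1 / n + 1 / (2 * n) := by
      unfold xeq; field_simp
    rw [abs_of_nonpos (by linarith)]
    linarith [hs.1]
  rcases (A.filter fun j => s < xeq n j).eq_empty_or_nonempty with hhi | hhi
  · refine ⟨A.max' hA, A.max'_mem hA, ?_⟩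
    have hs' : xeq n (A.max' hA) ≤ s :=
      not_lt.1 (Finset.filter_eq_empty_iff.1 hhi (A.max'_mem hA))
    have hcount : (A.max' hA).rev.1 ≤ countSubset (indicesBelow n) A :=
      le_countSubset (A.max' hA).rev.2.le fun k hk j hj => by
        have : j ≤ A.max' hA := A.le_max' j hj
        simp only [indicesBelow, Finset.mem_filter_univ]
        exact hk.trans_le (Fin.rev_le_rev.2 this)
    have hcount' : ((A.max' hA).rev.1 : ℝ) / n ≤ countSubset (indicesBelow n) A / n := by
      gcongr
    have hrev : ((A.max' hA).rev.1 : ℝ) + (A.max' hA).1 + 1 = n := by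
      have := (A.max' hA).2
      rw [Fin.val_rev]
      norm_cast
      omega
    have hxeq : xeq n (A.max' hA) = 1 - (A.max' hA).rev.1 / n - 1 / (2 * n) := by
      unfold xeq; field_simp; linarith
    rw [abs_of_nonneg (by linarith)]
    linarith [hs.2]
  · set a := (A.filter fun j => xeq n j ≤ s).max' hlo
    set b := (A.filter fun j => s < xeq n j).min' hhi
    obtain ⟨haA, has⟩ := Finset.mem_filter.1 (Finset.max'_mem _ hlo)
    obtain ⟨hbA, hbs⟩ := Finset.mem_filter.1 (Finset.min'_mem _ hhi)
    have hgap := gap_le_cyclicCost hmono hx hA (a := a.1) (b := b.1) b.2.le fun j hj => by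
      rcases le_or_gt (xeq n j) s with h | h
      · exact Or.inl (Finset.le_max' _ j (Finset.mem_filter.2 ⟨hj, h⟩))
      · exact Or.inr (Finset.min'_le _ j (Finset.mem_filter.2 ⟨hj, h⟩))
    have hxeq : (xeq n b - xeq n a) / 2 = ((b.1 : ℝ) - a.1) / (2 * n) := by
      unfold xeq; field_simp; ring
    rcases le_total (s - xeq n a) (xeq n b - s) with h | h
    · refine ⟨a, haA, ?_⟩
      rw [abs_of_nonneg (by linarith)]
      linarith
    · refine ⟨b, hbA, ?_⟩
      rw [abs_of_nonpos (by linarith)]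
      linarith

/-- near-optimality of the equispaced placement:
`C(x^eq) ≤ C(x) + (p/(1-p))·(2/n)` for every placement `x ∈ [0,1]^n`. -/
theorem expCost_xeq_near_optimal {n : ℕ} (hn : 1 ≤ n) (p : ℝ)
    (hp : p ∈ Set.Ioo (0:ℝ) 1)
    (x : Fin n → ℝ) (hx : ∀ i, x i ∈ Set.Icc (0:ℝ) 1) :
    expCost p (xeq n) ≤ expCost p x + p / (1 - p) * (2 / n) := by
  have : NeZero n := ⟨by omega⟩
  have hprob : ∀ A : Finset (Fin n), 0 ≤ prob p A := fun A =>
    mul_nonneg (pow_nonneg hp.1.le _) (pow_nonneg (by linarith [hp.2]) _)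
  have hmono := Tuple.monotone_sort x
  rw [← expCost_comp_perm p x (Tuple.sort x), expCost_eq_sum_cyclicCost p (x ∘ _)]
  have habove := sum_prob_mul_countSubset_le hp (card_indicesAbove n)
  have hbelow := sum_prob_mul_countSubset_le hp (card_indicesBelow n)
  calc expCost p (xeq n)
      ≤ ∑ A : Finset (Fin n), prob p A * (cyclicCost (x ∘ Tuple.sort x) A +
          (countSubset (indicesAbove n) A + countSubset (indicesBelow n) A) / n) :=
        Finset.sum_le_sum fun A _ => mul_le_mul_of_nonneg_left
          (cost0_xeq_le hmono (fun i => hx _) A) (hprob A)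
    _ = ∑ A : Finset (Fin n), prob p A * cyclicCost (x ∘ Tuple.sort x) A +
          (∑ A : Finset (Fin n), prob p A * countSubset (indicesAbove n) A +
            ∑ A : Finset (Fin n), prob p A * countSubset (indicesBelow n) A) / n := by
        rw [← Finset.sum_add_distrib, Finset.sum_div, ← Finset.sum_add_distrib]
        exact Finset.sum_congr rfl fun A _ => by ring
    _ ≤ ∑ A : Finset (Fin n), prob p A * cyclicCost (x ∘ Tuple.sort x) A +
          (p / (1 - p) + p / (1 - p)) / n := by gcongr
    _ = _ := by ring
end

section
/- Fix n ≥ 1 and p ∈ (0,1), and let x* be an optimal placement for the expected cost C (i.e., C(x*) ≤ C(x) for all x ∈ [0,1]^n). Then C̃(x^eq) ≤ C̃(x*) ≤ C(x*) ≤ C(x^eq). In particular, C̃(x) ≤ C(x) holds for every x ∈ [0,1]^n. -/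
open Finset MeasureTheory

/-- The distance on the circle of circumference 1 is at most the distance between any two lifts
to the line. -/
lemma min_abs_le_abs_sub_int (s y : ℝ) (m : ℤ) :
    min |s - y| (1 - |s - y|) ≤ |s - (y + m)| := by
  rcases lt_trichotomy m 0 with hm | rfl | hm
  · have hm' : (m : ℝ) ≤ -1 := by exact_mod_cast (by omega : m ≤ -1)
    refine (min_le_right _ _).trans ?_
    have h1 := le_abs_self (s - (y + m))
    have h2 := neg_abs_le (s - y)
    linarith
  · simp
  · have hm' : (1 : ℝ) ≤ m := by exact_mod_cast hm
    refine (min_le_right _ _).trans ?_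
    have h1 := neg_abs_le (s - (y + m))
    have h2 := le_abs_self (s - y)
    linarith

/-- A lower bound for the distance to all lifts of `y` bounds the circle distance to `y`. -/
lemma le_min_abs_of_forall_int {s y r : ℝ} (h1 : |s - y| ≤ 1)
    (h : ∀ m : ℤ, r ≤ |s - (y + m)|) : r ≤ min |s - y| (1 - |s - y|) := by
  refine le_min (by simpa using h 0) ?_
  rcases abs_cases (s - y) with ⟨he, h0⟩ | ⟨he, h0⟩
  · have := h 1
    push_cast at this
    rw [abs_of_nonpos (by linarith)] at this
    linarith
  · have := h (-1)
    push_cast at this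
    rw [abs_of_nonneg (by linarith)] at this
    linarith

lemma bddAbove_range_ccost {n : ℕ} (x : Fin n → ℝ) {A : Finset (Fin n)} (hA : A.Nonempty) :
    BddAbove (Set.range fun s : Set.Icc (0:ℝ) 1 =>
      ⨅ j : A, min |s.1 - x j.1| (1 - |s.1 - x j.1|)) := by
  obtain ⟨j, hj⟩ := hA
  refine ⟨1, ?_⟩
  rintro _ ⟨s, rfl⟩
  refine (ciInf_le (Set.finite_range _).bddBelow ⟨j, hj⟩).trans ?_
  refine (min_le_right _ _).trans ?_
  have := abs_nonneg (s.1 - x j)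
  linarith

lemma bddAbove_range_cost {n : ℕ} {x : Fin n → ℝ} (hx : ∀ i, x i ∈ Set.Icc (0:ℝ) 1)
    {A : Finset (Fin n)} (hA : A.Nonempty) :
    BddAbove (Set.range fun s : Set.Icc (0:ℝ) 1 => ⨅ j : A, |s.1 - x j.1|) := by
  obtain ⟨j, hj⟩ := hA
  refine ⟨1, ?_⟩
  rintro _ ⟨s, rfl⟩
  refine (ciInf_le (Set.finite_range _).bddBelow ⟨j, hj⟩).trans ?_
  have := s.2.1
  have := s.2.2
  have := (hx j).1
  have := (hx j).2
  exact abs_le.2 ⟨by linarith, by linarith⟩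

lemma ccost0_le_cost0 {n : ℕ} {x : Fin n → ℝ} (hx : ∀ i, x i ∈ Set.Icc (0:ℝ) 1)
    (A : Finset (Fin n)) : ccost0 x A ≤ cost0 x A := by
  unfold ccost0 cost0
  split_ifs with hA
  · refine ciSup_mono (bddAbove_range_cost hx hA) fun s => ?_
    exact ciInf_mono (Set.finite_range _).bddBelow fun j => min_le_left _ _
  · exact le_rfl

lemma prob_nonneg {n : ℕ} {p : ℝ} (hp : p ∈ Set.Ioo (0:ℝ) 1) (A : Finset (Fin n)) :
    0 ≤ prob p A :=
  mul_nonneg (pow_nonneg hp.1.le _) (pow_nonneg (by linarith [hp.2]) _)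

lemma prob_map {n : ℕ} (p : ℝ) (A : Finset (Fin n)) (e : Fin n ≃ Fin n) :
    prob p (A.map e.toEmbedding) = prob p A := by
  simp [prob]

lemma cExpCost_le_expCost {n : ℕ} {p : ℝ} (hp : p ∈ Set.Ioo (0:ℝ) 1) {x : Fin n → ℝ}
    (hx : ∀ i, x i ∈ Set.Icc (0:ℝ) 1) : cExpCost p x ≤ expCost p x :=
  Finset.sum_le_sum fun A _ => mul_le_mul_of_nonneg_left (ccost0_le_cost0 hx A) (prob_nonneg hp A)

/-- Permuting the sensors amounts to permuting the active set. -/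
lemma ccost0_comp {n : ℕ} (x : Fin n → ℝ) (A : Finset (Fin n)) (e : Fin n ≃ Fin n) :
    ccost0 (x ∘ e) A = ccost0 x (A.map e.toEmbedding) := by
  unfold ccost0
  simp only [Finset.map_nonempty]
  split_ifs with hA
  · congr 1
    funext s
    exact (e.subtypeEquiv (p := (· ∈ A)) (q := (· ∈ A.map e.toEmbedding)) (by simp)).iInf_congr
      fun j => rfl
  · rfl

lemma cExpCost_eq_sum_map {n : ℕ} (p : ℝ) (x : Fin n → ℝ) (e : Fin n ≃ Fin n) :
    cExpCost p x = ∑ A : Finset (Fin n), prob p A * ccost0 x (A.map e.toEmbedding) := by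
  unfold cExpCost
  rw [← e.finsetCongr.sum_comp]
  simp [Equiv.finsetCongr_apply, prob_map]

lemma cExpCost_comp {n : ℕ} (p : ℝ) (x : Fin n → ℝ) (e : Fin n ≃ Fin n) :
    cExpCost p (x ∘ e) = cExpCost p x := by
  rw [cExpCost_eq_sum_map p x e]
  simp [cExpCost, ccost0_comp]

/-- `k` is congruent modulo `n` to an index in `A`. -/
def IsLift {n : ℕ} (A : Finset (Fin n)) (k : ℤ) : Prop :=
  ∃ j ∈ A, ∃ m : ℤ, k = (j : ℤ) + m * n

lemma exists_eq_fin_add_mul {n : ℕ} (hn : 1 ≤ n) (k : ℤ) :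
    ∃ (j : Fin n) (m : ℤ), k = (j : ℤ) + m * n := by
  have h0 : 0 ≤ k % n := Int.emod_nonneg _ (by omega)
  have h1 : k % n < n := Int.emod_lt_of_pos _ (by omega)
  refine ⟨⟨(k % n).toNat, by omega⟩, k / n, ?_⟩
  have := Int.emod_add_mul_ediv k n
  simp only [Int.toNat_of_nonneg h0]
  linarith [mul_comm (n : ℤ) (k / n)]

/-- A monotone placement extends to a monotone quasi-periodic function on `ℤ`. -/
lemma exists_monotone_lift {n : ℕ} (hn : 1 ≤ n) {x : Fin n → ℝ}
    (hx : ∀ i, x i ∈ Set.Icc (0:ℝ) 1) (hmono : Monotone x) :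
    ∃ X : ℤ → ℝ, Monotone X ∧ ∀ (j : Fin n) (m : ℤ), X (j + m * n) = x j + m := by
  choose J M hJM using exists_eq_fin_add_mul hn
  have key : ∀ (i j : Fin n) (a b : ℤ), (i : ℤ) + a * n ≤ j + b * n → x i + a ≤ x j + b := by
    intro i j a b h
    have hi := i.2
    have hj := j.2
    rcases lt_trichotomy a b with hab | rfl | hab
    · have : (a : ℝ) + 1 ≤ b := by exact_mod_cast hab
      linarith [(hx i).2, (hx j).1]
    · have : i ≤ j := by
        rw [Fin.le_def]
        omega
      linarith [hmono this]
    · exfalso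
      have : (b + 1) * (n : ℤ) ≤ a * n := mul_le_mul_of_nonneg_right hab (by omega)
      rw [add_mul, one_mul] at this
      omega
  refine ⟨fun k => x (J k) + M k, fun k l hkl => key _ _ _ _ ?_, fun j m => ?_⟩
  · rwa [← hJM, ← hJM]
  · exact le_antisymm (key _ _ _ _ (hJM _).ge) (key _ _ _ _ (hJM _).le)

/-- Half the length of an arc free of active sensors is a lower bound for the circle cost. -/
lemma half_arc_le_ccost0 {n : ℕ} {x : Fin n → ℝ} (hx : ∀ i, x i ∈ Set.Icc (0:ℝ) 1)
    {X : ℤ → ℝ} (hX : Monotone X) (hXx : ∀ (j : Fin n) (m : ℤ), X (j + m * n) = x j + m)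
    {A : Finset (Fin n)} (hA : A.Nonempty) {b c : ℤ}
    (hfree : ∀ k, b < k → k < c → ¬ IsLift A k) :
    (X c - X b) / 2 ≤ ccost0 x A := by
  rw [ccost0, if_pos hA]
  have : Nonempty A := hA.to_subtype
  set z := (X b + X c) / 2 with hz
  have hs : Int.fract z ∈ Set.Icc (0:ℝ) 1 := ⟨Int.fract_nonneg _, (Int.fract_lt_one _).le⟩
  refine le_trans (le_ciInf fun j => ?_) (le_ciSup (bddAbove_range_ccost x hA) ⟨Int.fract z, hs⟩)
  refine le_min_abs_of_forall_int ?_ fun m => ?_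
  · have h1 := hx j.1
    exact abs_le.2 ⟨by linarith [hs.1, h1.2], by linarith [hs.2, h1.1]⟩
  · have hlift : IsLift A (j.1 + (m + ⌊z⌋) * n) := ⟨j.1, j.2, _, rfl⟩
    have hval := hXx j.1 (m + ⌊z⌋)
    push_cast at hval
    have hfr : Int.fract z - (x j.1 + m) = z - X (j.1 + (m + ⌊z⌋) * n) := by
      rw [hval, Int.fract]
      ring
    simp only [hfr]
    rcases le_or_gt (↑↑j.1 + (m + ⌊z⌋) * (n : ℤ)) b with hb | hb
    · refine le_trans ?_ (le_abs_self _)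
      linarith [hX hb]
    · have hc := le_of_not_gt fun hc => hfree _ hb hc hlift
      refine le_trans ?_ (neg_le_abs _)
      linarith [hX hc]

lemma xeq_mem {n : ℕ} (i : Fin n) : xeq n i ∈ Set.Icc (0:ℝ) 1 := by
  have hi : (i : ℝ) + 1 ≤ n := by exact_mod_cast i.2
  have h0 : (0 : ℝ) ≤ i := Nat.cast_nonneg _
  unfold xeq
  exact ⟨by positivity, (div_le_one (by linarith)).2 (by linarith)⟩

/-- The equispaced circle cost is at most half the length of some arc free of active sensors. -/
lemma exists_free_ccost0_xeq_le {n : ℕ} (hn : 1 ≤ n) {A : Finset (Fin n)} (hA : A.Nonempty) :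
    ∃ (b : ℤ) (g : ℕ), (∀ k, b < k → k < b + g → ¬ IsLift A k) ∧
      ccost0 (xeq n) A ≤ g / (2 * n) := by
  have hn0 : (0 : ℝ) < n := by exact_mod_cast hn
  have hnZ : (0 : ℤ) < n := by exact_mod_cast hn
  obtain ⟨j₀, hj₀⟩ := hA
  set S : Set ℕ := {g | ∃ b : ℤ, ∀ k, b < k → k < b + g → ¬ IsLift A k}
  have hSne : S.Nonempty := ⟨0, 0, fun k h1 h2 => by simp at h2; omega⟩
  -- Every window of `n` consecutive integers contains a lift of `j₀`.
  have hwin : ∀ b : ℤ, ∃ k, b < k ∧ k ≤ b + n ∧ IsLift A k := by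
    intro b
    have h0 : 0 ≤ (b - j₀) % n := Int.emod_nonneg _ (by omega)
    have h1 : (b - j₀) % n < n := Int.emod_lt_of_pos _ hnZ
    have h2 := Int.emod_add_mul_ediv (b - j₀) n
    have h3 : (n : ℤ) * ((b - j₀) / n) = (b - j₀) / n * n := mul_comm _ _
    refine ⟨j₀ + ((b - j₀) / n + 1) * n, ?_, ?_, j₀, hj₀, _, rfl⟩ <;>
    · rw [add_mul, one_mul]
      omega
  have hSbdd : BddAbove S := by
    refine ⟨n, ?_⟩
    rintro g ⟨b, hb⟩
    by_contra! hg
    obtain ⟨k, hk1, hk2, hk⟩ := hwin b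
    exact hb k hk1 (by omega) hk
  obtain ⟨b, hb⟩ := Nat.sSup_mem hSne hSbdd
  refine ⟨b, sSup S, hb, ?_⟩
  have hAne : A.Nonempty := ⟨j₀, hj₀⟩
  rw [ccost0, if_pos hAne]
  have : Nonempty (Set.Icc (0:ℝ) 1) := ⟨⟨0, by simp⟩⟩
  refine ciSup_le fun s => ?_
  have hdist : ∀ k : ℤ, IsLift A k →
      ⨅ j : A, min |s.1 - xeq n j.1| (1 - |s.1 - xeq n j.1|) ≤
        |s.1 - (2 * k + 1) / (2 * n)| := by
    rintro k ⟨j, hj, m, rfl⟩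
    refine (ciInf_le (Set.finite_range _).bddBelow ⟨j, hj⟩).trans ?_
    refine (min_abs_le_abs_sub_int s.1 (xeq n j) m).trans_eq ?_
    congr 2
    unfold xeq
    push_cast
    field_simp
    ring
  -- `q` is the last integer whose equispaced position is at most `s`.
  obtain ⟨q, hq⟩ : ∃ q : ℤ, q = ⌊s.1 * n - 1 / 2⌋ := ⟨_, rfl⟩
  have hpos : ∀ k : ℤ, (2 * (k : ℝ) + 1) / (2 * n) ≤ s.1 ↔ k ≤ q := by
    intro k
    rw [hq, Int.le_floor, div_le_iff₀ (by positivity)]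
    constructor <;> intro h <;> linarith
  obtain ⟨u, ⟨huq, hu⟩, humax⟩ := Int.exists_greatest_of_bdd
    (P := fun k => k ≤ q ∧ IsLift A k) ⟨q, fun k hk => hk.1⟩ (by
      obtain ⟨k, -, hk2, hk⟩ := hwin (q - n)
      exact ⟨k, by omega, hk⟩)
  obtain ⟨v, ⟨hvq, hv⟩, hvmin⟩ := Int.exists_least_of_bdd
    (P := fun k => q < k ∧ IsLift A k) ⟨q, fun k hk => hk.1.le⟩ (by
      obtain ⟨k, hk1, -, hk⟩ := hwin q
      exact ⟨k, hk1, hk⟩)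
  have hmem : (v - u).toNat ∈ S := by
    refine ⟨u, fun k hk1 hk2 hk => ?_⟩
    rcases le_or_gt k q with h | h
    · have := humax k ⟨h, hk⟩
      omega
    · have := hvmin k ⟨h, hk⟩
      omega
  have hgap : (v : ℝ) - u ≤ (sSup S : ℕ) := by
    have h1 := le_csSup hSbdd hmem
    have h2 : v - u ≤ (sSup S : ℕ) := by omega
    exact_mod_cast h2
  have hu1 := (hpos u).2 huq
  have hv1 := not_le.1 (mt (hpos v).1 (not_le.2 hvq))
  have du := hdist u hu
  have dv := hdist v hv
  rw [abs_of_nonneg (by linarith)] at du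
  rw [abs_of_nonpos (by linarith)] at dv
  have hsum : (2 * (v : ℝ) + 1) / (2 * n) - (2 * u + 1) / (2 * n) = 2 * ((v - u) / (2 * n)) := by
    ring
  have hfin : ((v : ℝ) - u) / (2 * n) ≤ (sSup S : ℕ) / (2 * n) := by gcongr
  linarith

lemma isLift_of_isLift_map_addRight {n : ℕ} [NeZero n] {A : Finset (Fin n)} {t : Fin n} {k : ℤ}
    (h : IsLift (A.map (Equiv.addRight t).toEmbedding) k) : IsLift A (k - t) := by
  obtain ⟨i, hi, m, rfl⟩ := h
  obtain ⟨j, hj, rfl⟩ := Finset.mem_map.1 hi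
  refine ⟨j, hj, m - ((j : ℤ) + t) / n, ?_⟩
  simp only [Equiv.coe_toEmbedding, Equiv.coe_addRight, Fin.val_add]
  push_cast
  have := Int.emod_add_mul_ediv ((j : ℤ) + t) n
  linear_combination this

/-- The arcs spanning `g` consecutive gaps have total length `g`. -/
lemma sum_arc {n : ℕ} {X : ℤ → ℝ} (hX : ∀ k, X (k + n) = X k + 1) (b : ℤ) (g : ℕ) :
    ∑ t : Fin n, (X (b + t + g) - X (b + t)) = g := by
  rw [Fin.sum_univ_eq_sum_range fun t : ℕ => X (b + t + g) - X (b + t)]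
  induction g with
  | zero => simp
  | succ g ih =>
    have htel := Finset.sum_range_sub (fun t : ℕ => X (b + t + g)) n
    have hper : X (b + n + g) = X (b + g) + 1 := by
      rw [← hX]
      congr 1
      ring
    simp only [Nat.cast_zero, add_zero, hper] at htel
    calc ∑ t ∈ Finset.range n, (X (b + t + (g + 1 : ℕ)) - X (b + t))
        = ∑ t ∈ Finset.range n, (X (b + (t + 1 : ℕ) + g) - X (b + t + g)) +
          ∑ t ∈ Finset.range n, (X (b + t + g) - X (b + t)) := by
          rw [← Finset.sum_add_distrib]
          refine Finset.sum_congr rfl fun t _ => ?_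
          have : b + t + (g + 1 : ℕ) = b + (t + 1 : ℕ) + (g : ℤ) := by
            push_cast
            ring
          rw [this]
          ring
      _ = (g + 1 : ℕ) := by
          rw [htel, ih]
          push_cast
          ring

/-- The equispaced circle cost is at most the average, over rotations of the active set, of the
circle cost of any monotone placement. -/
lemma card_mul_ccost0_xeq_le {n : ℕ} [NeZero n] {x : Fin n → ℝ}
    (hx : ∀ i, x i ∈ Set.Icc (0:ℝ) 1) (hmono : Monotone x) (A : Finset (Fin n)) :
    n * ccost0 (xeq n) A ≤ ∑ t : Fin n, ccost0 x (A.map (Equiv.addRight t).toEmbedding) := by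
  have hn : 1 ≤ n := NeZero.one_le
  have hn0 : (0 : ℝ) < n := by exact_mod_cast hn
  rcases A.eq_empty_or_nonempty with rfl | hA
  · simp [ccost0]
  obtain ⟨X, hX, hXx⟩ := exists_monotone_lift hn hx hmono
  have hper : ∀ k, X (k + n) = X k + 1 := by
    intro k
    obtain ⟨j, m, rfl⟩ := exists_eq_fin_add_mul hn k
    have h : (j : ℤ) + m * n + n = j + (m + 1) * n := by ring
    rw [h, hXx, hXx]
    push_cast
    ring
  obtain ⟨b, g, hfree, hle⟩ := exists_free_ccost0_xeq_le hn hA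
  calc n * ccost0 (xeq n) A ≤ n * (g / (2 * n)) := by gcongr
    _ = (∑ t : Fin n, (X (b + t + g) - X (b + t))) / 2 := by
        rw [sum_arc hper]
        field_simp
    _ = ∑ t : Fin n, (X (b + t + g) - X (b + t)) / 2 := Finset.sum_div _ _ _
    _ ≤ _ := Finset.sum_le_sum fun t _ =>
        half_arc_le_ccost0 hx hX hXx (hA.map) fun k hk1 hk2 hk =>
          hfree (k - t) (by omega) (by omega) (isLift_of_isLift_map_addRight hk)

/-- The equispaced placement minimizes the expected circle cost. -/
lemma cExpCost_xeq_le {n : ℕ} (hn : 1 ≤ n) {p : ℝ} (hp : p ∈ Set.Ioo (0:ℝ) 1) {x : Fin n → ℝ}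
    (hx : ∀ i, x i ∈ Set.Icc (0:ℝ) 1) : cExpCost p (xeq n) ≤ cExpCost p x := by
  have : NeZero n := ⟨by omega⟩
  have hn0 : (0 : ℝ) < n := by exact_mod_cast hn
  rw [← cExpCost_comp p x (Tuple.sort x)]
  refine le_of_mul_le_mul_left ?_ hn0
  calc n * cExpCost p (xeq n)
      = ∑ A : Finset (Fin n), prob p A * (n * ccost0 (xeq n) A) := by
        rw [cExpCost, Finset.mul_sum]
        exact Finset.sum_congr rfl fun A _ => by ring
    _ ≤ ∑ A : Finset (Fin n), prob p A *
          ∑ t : Fin n, ccost0 (x ∘ Tuple.sort x) (A.map (Equiv.addRight t).toEmbedding) :=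
        Finset.sum_le_sum fun A _ => mul_le_mul_of_nonneg_left
          (card_mul_ccost0_xeq_le (fun i => hx _) (Tuple.monotone_sort x) A) (prob_nonneg hp A)
    _ = ∑ t : Fin n, cExpCost p (x ∘ Tuple.sort x) := by
        simp_rw [Finset.mul_sum]
        rw [Finset.sum_comm]
        exact Finset.sum_congr rfl fun t _ => (cExpCost_eq_sum_map p _ (Equiv.addRight t)).symm
    _ = n * cExpCost p (x ∘ Tuple.sort x) := by simp

/-- for an optimal placement `x*`,
`C̃(x^eq) ≤ C̃(x*) ≤ C(x*) ≤ C(x^eq)`; in particular `C̃(x) ≤ C(x)` for every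
`x ∈ [0,1]^n`. -/
theorem circle_line_sandwich {n : ℕ} (hn : 1 ≤ n) (p : ℝ)
    (hp : p ∈ Set.Ioo (0:ℝ) 1)
    (xs : Fin n → ℝ) (hxs : ∀ i, xs i ∈ Set.Icc (0:ℝ) 1)
    (hopt : ∀ x : Fin n → ℝ, (∀ i, x i ∈ Set.Icc (0:ℝ) 1) →
      expCost p xs ≤ expCost p x) :
    (cExpCost p (xeq n) ≤ cExpCost p xs ∧
      cExpCost p xs ≤ expCost p xs ∧
      expCost p xs ≤ expCost p (xeq n)) ∧
    ∀ x : Fin n → ℝ, (∀ i, x i ∈ Set.Icc (0:ℝ) 1) →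
      cExpCost p x ≤ expCost p x := by
  exact ⟨⟨cExpCost_xeq_le hn hp hxs, cExpCost_le_expCost hp hxs, hopt _ xeq_mem⟩,
    fun x hx => cExpCost_le_expCost hp hx⟩
end
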